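/- For integers m, n, let X_{m,n} be the number of leaves among the children of the root of a tree drawn uniformly at random from the associative trees of size m on n variables. Then for every n the limit e_n := lim_{m→∞} E[X_{m,n}] exists, and e_n ∼ 2√(2n) as n → ∞, i.e. e_n/(2√(2n)) → 1. -/

import Mathlib

/-- An and/or tree skeleton: leaves carry a variable index and a polarity
(`true` = positive literal, `false` = negated literal); internal nodes carry
a connective (`true` = AND, `false` = OR) and a list of children. -/
inductive AT (n : ℕ) : Type
  | leaf : Fin n → Bool → AT n
  | node : Bool → List (AT n) → AT n

namespace AT

/-- The connective at the root, if the root is an internal node. -/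
def rootConn {n : ℕ} : AT n → Option Bool
  | .leaf _ _ => none
  | .node c _ => some c

/-- Whether a tree is a single leaf. -/
def isLeafB {n : ℕ} : AT n → Bool
  | .leaf _ _ => true
  | .node _ _ => false

/-- The children of the root. -/
def rootChildren {n : ℕ} : AT n → List (AT n)
  | .leaf _ _ => []
  | .node _ ts => ts

/-- Well-formedness: an associative tree is a plane tree in which each internal
node has at least two children, no internal node has the same connective as its
parent (stratification), and leaves carry literals. -/
inductive WF {n : ℕ} : AT n → Prop
  | leaf (i : Fin n) (b : Bool) : WF (.leaf i b)
  | node (c : Bool) (ts : List (AT n)) :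
      2 ≤ ts.length → (∀ t ∈ ts, WF t) → (∀ t ∈ ts, rootConn t ≠ some c) →
      WF (.node c ts)

mutual
/-- The size of a tree: its total number of nodes. -/
def size {n : ℕ} : AT n → ℕ
  | .leaf _ _ => 1
  | .node _ ts => 1 + sizeList ts
def sizeList {n : ℕ} : List (AT n) → ℕ
  | [] => 0
  | t :: ts => size t + sizeList ts
end

mutual
/-- The Boolean function computed by a tree. -/
def eval {n : ℕ} : AT n → (Fin n → Bool) → Bool
  | .leaf i b, x => if b then x i else ! x i
  | .node c ts, x => evalList c ts x
def evalList {n : ℕ} : Bool → List (AT n) → (Fin n → Bool) → Bool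
  | c, [], _ => c
  | c, t :: ts, x => if c then eval t x && evalList c ts x
                     else eval t x || evalList c ts x
end

end AT

open AT

/-- Number of associative trees of size `m` in a family `𝒯`. -/
noncomputable def countIn (n : ℕ) (𝒯 : Set (AT n)) (m : ℕ) : ℕ :=
  Nat.card {t : AT n // t ∈ 𝒯 ∧ WF t ∧ size t = m}

/-- `A n m` is the number of associative trees of size `m` on `n` variables. -/
noncomputable def A (n m : ℕ) : ℕ := countIn n Set.univ m

/-- `Pmn n m f` is the proportion, among associative trees of size `m` on `n`
variables, of those computing the Boolean function `f`. -/
noncomputable def Pmn (n m : ℕ) (f : (Fin n → Bool) → Bool) : ℝ :=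
  (countIn n {t | eval t = f} m : ℝ) / (A n m : ℝ)

/-- Ratio of trees of size `m` in the family `𝒯` among all trees of size `m`. -/
noncomputable def ratio (n : ℕ) (𝒯 : Set (AT n)) (m : ℕ) : ℝ :=
  (countIn n 𝒯 m : ℝ) / (A n m : ℝ)

/-- `HasLimRatio n 𝒯 μ` : the limiting ratio of the family `𝒯` exists and is `μ`. -/
def HasLimRatio (n : ℕ) (𝒯 : Set (AT n)) (μ : ℝ) : Prop :=
  Filter.Tendsto (ratio n 𝒯) Filter.atTop (nhds μ)

/-- Extension of a Boolean function of `n₀` variables to `n ≥ n₀` variables. -/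
def extend {n₀ n : ℕ} (h : n₀ ≤ n) (f : (Fin n₀ → Bool) → Bool) :
    (Fin n → Bool) → Bool :=
  fun x => f (fun j => x (Fin.castLE h j))

open Classical in
/-- The tree size complexity of a Boolean function. -/
noncomputable def Lcomp (n : ℕ) (f : (Fin n → Bool) → Bool) : ℕ :=
  if f = (fun _ => true) ∨ f = (fun _ => false) then 0
  else if ∃ i : Fin n, f = (fun x => x i) ∨ f = (fun x => ! x i) then 2
  else sInf {m | ∃ t : AT n, WF t ∧ size t = m ∧ eval t = f}

/-- The number of leaves among the children of the root of `t`. -/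
def numLeafChildren {n : ℕ} (t : AT n) : ℕ :=
  ((rootChildren t).filter (fun s => isLeafB s)).length

/-- The expectation `E[X_{m,n}]` of the number of leaves among the children of the
root of a uniformly random associative tree of size `m` on `n` variables: the total
number of (tree, leaf-child) pairs divided by the number of trees. -/
noncomputable def EX (n m : ℕ) : ℝ :=
  (Nat.card {p : AT n × ℕ // WF p.1 ∧ size p.1 = m ∧ p.2 < numLeafChildren p.1} : ℝ)
    / (A n m : ℝ)


section GF
open PowerSeries

/-- Every size class is finite. -/
def FF {α : Type} (s : α → ℕ) : Prop := ∀ m, Finite {x // s x = m}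

/-- Weighted generating function. -/
noncomputable def wgf {α : Type} (s : α → ℕ) (w : α → ℝ) : PowerSeries ℝ :=
  PowerSeries.mk fun m => ∑ᶠ x : {x // s x = m}, w x

theorem FF.inj {α β : Type} {s : α → ℕ} {s' : β → ℕ} (h : FF s') (f : α → β)
    (hf : Function.Injective f) (hs : ∀ x, s' (f x) = s x) : FF s := by
  intro m
  have := h m
  exact Finite.of_injective (fun x : {x // s x = m} => (⟨f x.1, by rw [hs, x.2]⟩ : {x // s' x = m}))
    (fun x y hxy => Subtype.ext (hf (by simpa using hxy)))

theorem wgf_equiv {α β : Type} {s : α → ℕ} {s' : β → ℕ} {w : α → ℝ} {w' : β → ℝ} (e : α ≃ β)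
    (hs : ∀ x, s' (e x) = s x) (hw : ∀ x, w' (e x) = w x) : wgf s w = wgf s' w' := by
  ext m
  simp only [wgf, coeff_mk]
  refine finsum_eq_of_bijective (e.subtypeEquiv (fun x => by rw [hs])) (Equiv.bijective _) ?_
  rintro ⟨x, hx⟩
  simp [hw]

theorem wgf_sum {α β : Type} {s : α → ℕ} {s' : β → ℕ} (w : α → ℝ) (w' : β → ℝ)
    (h : FF s) (h' : FF s') :
    wgf (Sum.elim s s') (Sum.elim w w') = wgf s w + wgf s' w' := by
  ext m
  have := h m
  have := h' m
  have := Fintype.ofFinite {x // s x = m}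
  have := Fintype.ofFinite {x // s' x = m}
  simp only [wgf, coeff_mk, map_add]
  have e : (∑ᶠ x : {x // s x = m}, w x) + (∑ᶠ x : {x // s' x = m}, w' x) =
      ∑ᶠ x : {x // s x = m} ⊕ {x // s' x = m}, Sum.elim (fun x => w x.1) (fun x => w' x.1) x := by
    simp only [finsum_eq_sum_of_fintype, Fintype.sum_sum_type, Sum.elim_inl, Sum.elim_inr]
  rw [e]
  refine finsum_eq_of_bijective (Equiv.subtypeSum) (Equiv.bijective _) ?_
  rintro ⟨x | x, hx⟩ <;> rfl

theorem wgf_prod {α β : Type} {s : α → ℕ} {s' : β → ℕ} (w : α → ℝ) (w' : β → ℝ)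
    (h : FF s) (h' : FF s') :
    wgf (fun p : α × β => s p.1 + s' p.2) (fun p => w p.1 * w' p.2) = wgf s w * wgf s' w' := by
  ext m
  have := fun m => h m
  have := fun m => h' m
  have := fun m => Fintype.ofFinite {x // s x = m}
  have := fun m => Fintype.ofFinite {x // s' x = m}
  rw [coeff_mul]
  simp only [wgf, coeff_mk]
  simp only [finsum_eq_sum_of_fintype, Fintype.sum_mul_sum, ← Fintype.sum_prod_type']
  rw [← Finset.sum_coe_sort, ← Fintype.sum_sigma', ← finsum_eq_sum_of_fintype]
  symm
  refine finsum_eq_of_bijective (fun q => ⟨(q.2.1.1, q.2.2.1), ?_⟩) ⟨?_, ?_⟩ ?_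
  · have := q.1.2
    rw [Finset.HasAntidiagonal.mem_antidiagonal] at this
    simp [q.2.1.2, q.2.2.2, this]
  · rintro ⟨⟨⟨i, j⟩, hij⟩, ⟨x, hx⟩, ⟨y, hy⟩⟩ ⟨⟨⟨i', j'⟩, hij'⟩, ⟨x', hx'⟩, ⟨y', hy'⟩⟩ hh
    simp only [Subtype.mk.injEq, Prod.mk.injEq] at hh
    obtain ⟨rfl, rfl⟩ := hh
    dsimp only at hx hx' hy hy'
    subst hx hx' hy hy'
    rfl
  · rintro ⟨⟨x, y⟩, hxy⟩
    exact ⟨⟨⟨(s x, s' y), by simpa using hxy⟩, ⟨x, rfl⟩, ⟨y, rfl⟩⟩, rfl⟩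
  · intro q
    rfl

theorem wgf_add {α : Type} {s : α → ℕ} (w w' : α → ℝ) (h : FF s) :
    wgf s (fun x => w x + w' x) = wgf s w + wgf s w' := by
  ext m
  have := h m
  simp only [wgf, coeff_mk, map_add]
  exact finsum_add_distrib (Set.toFinite _) (Set.toFinite _)

theorem wgf_zero {α : Type} (s : α → ℕ) : wgf s (fun _ => 0) = 0 := by
  ext m
  simp [wgf]

theorem wgf_shift {α : Type} (s : α → ℕ) (w : α → ℝ) :
    wgf (fun x => 1 + s x) w = X * wgf s w := by
  ext m
  cases m with
  | zero =>
    have : IsEmpty {x // 1 + s x = 0} := ⟨fun x => by have := x.2; omega⟩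
    simp [wgf, finsum_of_isEmpty]
  | succ m =>
    rw [coeff_succ_X_mul]
    simp only [wgf, coeff_mk]
    refine finsum_eq_of_bijective (Equiv.subtypeEquivRight (fun x => by omega)) (Equiv.bijective _) ?_
    rintro ⟨x, hx⟩
    rfl

theorem wgf_const {α : Type} [Finite α] (k : ℕ) :
    wgf (fun _ : α => k) (fun _ => 1) = (Nat.card α : PowerSeries ℝ) * X ^ k := by
  ext m
  have := Fintype.ofFinite α
  rw [show (Nat.card α : PowerSeries ℝ) = C (Nat.card α : ℝ) by simp, coeff_C_mul, coeff_X_pow]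
  simp only [wgf, coeff_mk]
  by_cases h : m = k
  · subst h
    have : (∑ᶠ x : {x : α // m = m}, (1 : ℝ)) = ∑ᶠ x : α, (1 : ℝ) :=
      finsum_eq_of_bijective (Equiv.subtypeUnivEquiv (fun _ => rfl)) (Equiv.bijective _) (fun _ => rfl)
    rw [this, finsum_eq_sum_of_fintype]
    simp
  · have : IsEmpty {x : α // k = m} := ⟨fun x => h x.2.symm⟩
    simp [h, finsum_of_isEmpty]

theorem FF_const {α : Type} [Finite α] (k : ℕ) : FF (fun _ : α => k) := fun _ => inferInstance

theorem coeff_wgf_one {α : Type} {s : α → ℕ} (h : FF s) (m : ℕ) :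
    coeff m (wgf s (fun _ => 1)) = (Nat.card {x // s x = m} : ℝ) := by
  have := h m
  have := Fintype.ofFinite {x // s x = m}
  simp [wgf, finsum_eq_sum_of_fintype]

theorem coeff_wgf_nat {α : Type} {s : α → ℕ} (h : FF s) (w : α → ℕ) (m : ℕ) :
    coeff m (wgf s (fun x => (w x : ℝ))) = (Nat.card {p : α × ℕ // s p.1 = m ∧ p.2 < w p.1} : ℝ) := by
  have := h m
  have := Fintype.ofFinite {x // s x = m}
  have e : {p : α × ℕ // s p.1 = m ∧ p.2 < w p.1} ≃ (Σ x : {x // s x = m}, Fin (w x.1)) :=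
    { toFun := fun p => ⟨⟨p.1.1, p.2.1⟩, ⟨p.1.2, p.2.2⟩⟩
      invFun := fun q => ⟨(q.1.1, q.2.1), q.1.2, q.2.2⟩
      left_inv := fun _ => rfl
      right_inv := fun _ => rfl }
  rw [Nat.card_congr e, Nat.card_sigma]
  simp [wgf, finsum_eq_sum_of_fintype]

end GF

section Trees
open PowerSeries

theorem AT.size_pos {n : ℕ} (t : AT n) : 1 ≤ size t := by
  cases t <;> simp [size]

theorem AT.sizeList_length {n : ℕ} (ts : List (AT n)) : ts.length ≤ sizeList ts := by
  induction ts with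
  | nil => simp
  | cons t ts ih =>
    have := AT.size_pos t
    simp only [sizeList, List.length_cons]
    omega

theorem AT.size_le_sizeList {n : ℕ} (ts : List (AT n)) (t : AT n) (h : t ∈ ts) :
    size t ≤ sizeList ts := by
  induction ts with
  | nil => simp at h
  | cons t' ts ih =>
    simp only [sizeList]
    rcases List.mem_cons.1 h with rfl | h
    · omega
    · have := ih h
      omega

theorem AT.finite_le {n : ℕ} (m : ℕ) : {t : AT n | size t ≤ m}.Finite := by
  induction m with
  | zero =>
    convert Set.finite_empty
    ext t
    have := AT.size_pos t
    simp only [Set.mem_ofPred_eq, Set.mem_empty_iff_false, iff_false]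
    omega
  | succ m ih =>
    have : Finite {t : AT n // size t ≤ m} := ih
    have h1 : (Set.range (fun p : Fin n × Bool => AT.leaf p.1 p.2)).Finite := Set.finite_range _
    have h2 := (List.finite_length_le {t : AT n // size t ≤ m} m).image (List.map Subtype.val)
    have h3 := h2.image (AT.node true)
    have h4 := h2.image (AT.node false)
    refine (h1.union (h3.union h4)).subset ?_
    intro t ht
    cases t with
    | leaf i b => exact Or.inl ⟨(i, b), rfl⟩
    | node c ts =>
      right
      simp only [Set.mem_ofPred_eq, size] at ht
      have hmem : ts ∈ List.map Subtype.val ''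
          {l : List {t : AT n // size t ≤ m} | l.length ≤ m} := by
        have hl : ∀ t ∈ ts, size t ≤ m := fun t h => by
          have := AT.size_le_sizeList ts t h
          omega
        have hlen := AT.sizeList_length ts
        lift ts to List {t : AT n // size t ≤ m} using hl
        refine ⟨ts, ?_, rfl⟩
        simp only [List.length_map] at hlen
        simp only [Set.mem_ofPred_eq]
        omega
      cases c
      · exact Or.inr ⟨ts, hmem, rfl⟩
      · exact Or.inl ⟨ts, hmem, rfl⟩

theorem FF_size {n : ℕ} : FF (size : AT n → ℕ) := fun m =>
  ((AT.finite_le m).subset (fun _ h => le_of_eq h) : {t : AT n | size t = m}.Finite)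

/-- Trees whose root does not carry `c`. -/
abbrev Tc (n : ℕ) (c : Bool) := {t : AT n // WF t ∧ rootConn t ≠ some c}

/-- All well-formed trees. -/
abbrev Wt (n : ℕ) := {t : AT n // WF t}

/-- Size of a list of subtrees. -/
def lsz {n : ℕ} {c : Bool} (l : List (Tc n c)) : ℕ := sizeList (l.map Subtype.val)

/-- Number of leaves in a list. -/
def lfc {n : ℕ} (l : List (AT n)) : ℕ := (l.filter (fun s => isLeafB s)).length

/-- Lists with at least two entries. -/
abbrev Nc (n : ℕ) (c : Bool) := {l : List (Tc n c) // 2 ≤ l.length}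

theorem FF_Tc (n : ℕ) (c : Bool) : FF (fun t : Tc n c => size t.1) :=
  FF_size.inj _ Subtype.val_injective (fun _ => rfl)

theorem FF_lsz (n : ℕ) (c : Bool) : FF (lsz : List (Tc n c) → ℕ) := by
  have h : FF (fun t : AT n => size t - 1) := by
    intro m
    refine ((AT.finite_le (m + 1)).subset (fun t h => ?_) : {t : AT n | size t - 1 = m}.Finite)
    simp only [Set.mem_ofPred_eq] at h ⊢
    omega
  refine h.inj (fun l => AT.node true (l.map Subtype.val)) ?_ ?_
  · intro l l' hh
    simp only [AT.node.injEq, true_and] at hh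
    exact List.map_injective_iff.2 Subtype.val_injective hh
  · intro l
    simp [size, lsz]

theorem FF_Nc (n : ℕ) (c : Bool) : FF (fun l : Nc n c => lsz l.1) :=
  (FF_lsz n c).inj _ Subtype.val_injective (fun _ => rfl)

theorem FF_Nc1 (n : ℕ) (c : Bool) : FF (fun l : Nc n c => 1 + lsz l.1) := by
  intro m
  cases m with
  | zero =>
    have : IsEmpty {x : Nc n c // 1 + lsz x.1 = 0} := ⟨fun x => by have := x.2; omega⟩
    infer_instance
  | succ m =>
    have := FF_Nc n c m
    exact Finite.of_equiv _ (Equiv.subtypeEquivRight (fun x => by omega) :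
      {x : Nc n c // lsz x.1 = m} ≃ {x : Nc n c // 1 + lsz x.1 = m + 1})

/-- Indicator of being a leaf. -/
def lfw {n : ℕ} (t : AT n) : ℕ := if isLeafB t then 1 else 0

theorem lfc_cons {n : ℕ} (t : AT n) (l : List (AT n)) : lfc (t :: l) = lfw t + lfc l := by
  unfold lfc lfw
  rw [List.filter_cons]
  split_ifs <;> simp [add_comm]

/-- Generating functions. -/
noncomputable def gT (n : ℕ) (c : Bool) : PowerSeries ℝ :=
  wgf (fun t : Tc n c => size t.1) (fun _ => 1)
noncomputable def gL (n : ℕ) (c : Bool) : PowerSeries ℝ := wgf (lsz : List (Tc n c) → ℕ) (fun _ => 1)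
noncomputable def gP (n : ℕ) (c : Bool) : PowerSeries ℝ :=
  wgf (lsz : List (Tc n c) → ℕ) (fun l => (lfc (l.map Subtype.val) : ℝ))

/-- Decomposition of lists. -/
def listEquiv (α : Type) : Unit ⊕ (α × List α) ≃ List α where
  toFun := Sum.elim (fun _ => []) (fun p => p.1 :: p.2)
  invFun l := match l with
    | [] => Sum.inl ()
    | a :: l => Sum.inr (a, l)
  left_inv := by rintro (_ | ⟨a, l⟩) <;> rfl
  right_inv := by rintro (_ | ⟨a, l⟩) <;> rfl

theorem FF_cons (n : ℕ) (c : Bool) :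
    FF (fun p : Tc n c × List (Tc n c) => size p.1.1 + lsz p.2) :=
  (FF_lsz n c).inj (fun p => p.1 :: p.2) (by rintro ⟨a, b⟩ ⟨c, d⟩ h; simpa using h)
    (fun _ => rfl)

theorem gL_eq (n : ℕ) (c : Bool) : gL n c = 1 + gT n c * gL n c := by
  have h := wgf_sum (s := fun _ : Unit => 0)
    (s' := fun p : Tc n c × List (Tc n c) => size p.1.1 + lsz p.2) (fun _ => 1) (fun _ => 1 * 1)
    (FF_const 0) (FF_cons n c)
  rw [wgf_prod (s := fun t : Tc n c => size t.1) (s' := lsz) (fun _ => 1) (fun _ => 1)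
    (FF_Tc n c) (FF_lsz n c), wgf_const] at h
  simp only [Nat.card_unique, Nat.cast_one, pow_zero, mul_one] at h
  unfold gL gT at *
  rw [← h]
  symm
  refine wgf_equiv (listEquiv _) ?_ ?_
  · rintro (_ | ⟨a, l⟩) <;> rfl
  · rintro (_ | ⟨a, l⟩) <;> simp

theorem gleaf_eq (n : ℕ) (c : Bool) :
    wgf (fun t : Tc n c => size t.1) (fun t => (lfw t.1 : ℝ)) = (2 * n : ℝ) • X := by
  have h := wgf_sum (s := fun _ : Fin n × Bool => 1)
    (s' := fun t : {t : Tc n c // isLeafB t.1 = false} => size t.1.1) (fun _ => 1) (fun _ => 0)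
    (FF_const 1) ((FF_Tc n c).inj _ Subtype.val_injective (fun _ => rfl))
  rw [wgf_const, wgf_zero] at h
  have h2 : (Nat.card (Fin n × Bool) : PowerSeries ℝ) * X ^ 1 + 0 = (2 * n : ℝ) • X := by
    have h2 : (C (2 : ℝ) : PowerSeries ℝ) = 2 := map_ofNat C 2
    rw [smul_eq_C_mul]
    simp [h2, mul_comm]
  rw [← h2, ← h]
  symm
  let f : (Fin n × Bool) ⊕ {t : Tc n c // isLeafB t.1 = false} → Tc n c :=
    Sum.elim (fun p => ⟨AT.leaf p.1 p.2, WF.leaf _ _, by simp [rootConn]⟩) (fun t => t.1)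
  have hf : Function.Bijective f := by
    constructor
    · rintro (⟨i, b⟩ | ⟨⟨t, ht⟩, ht'⟩) (⟨i', b'⟩ | ⟨⟨u, hu⟩, hu'⟩) hh
      · simpa [f] using hh
      · simp only [f, Sum.elim_inl, Sum.elim_inr, Subtype.mk.injEq] at hh
        subst hh
        simp [isLeafB] at hu'
      · simp only [f, Sum.elim_inl, Sum.elim_inr, Subtype.mk.injEq] at hh
        subst hh
        simp [isLeafB] at ht'
      · simpa [f] using hh
    · rintro ⟨t, ht⟩
      cases t with
      | leaf i b => exact ⟨Sum.inl (i, b), rfl⟩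
      | node d ts => exact ⟨Sum.inr ⟨⟨_, ht⟩, rfl⟩, rfl⟩
  refine wgf_equiv (Equiv.ofBijective f hf) ?_ ?_
  · rintro (⟨i, b⟩ | ⟨⟨t, ht⟩, ht'⟩) <;> simp [f, size]
  · rintro (⟨i, b⟩ | ⟨⟨t, ht⟩, ht'⟩)
    · exact Nat.cast_one
    · simp only at ht'
      simp [f, lfw, ht']

theorem gP_eq (n : ℕ) (c : Bool) :
    gP n c = ((2 * n : ℝ) • X) * gL n c + gT n c * gP n c := by
  have h := wgf_sum (s := fun _ : Unit => 0)
    (s' := fun p : Tc n c × List (Tc n c) => size p.1.1 + lsz p.2) (fun _ => 0)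
    (fun p => (lfw p.1.1 : ℝ) * 1 + 1 * (lfc (p.2.map Subtype.val) : ℝ))
    (FF_const 0) (FF_cons n c)
  rw [wgf_add _ _ (FF_cons n c), wgf_prod (s := fun t : Tc n c => size t.1) (s' := lsz)
      (fun t => (lfw t.1 : ℝ)) (fun _ => 1) (FF_Tc n c) (FF_lsz n c),
    wgf_prod (s := fun t : Tc n c => size t.1) (s' := lsz)
      (fun _ => 1) (fun l => (lfc (l.map Subtype.val) : ℝ)) (FF_Tc n c) (FF_lsz n c),
    wgf_zero, gleaf_eq, zero_add] at h
  unfold gP gL gT at *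
  rw [← h]
  symm
  refine wgf_equiv (listEquiv _) ?_ ?_
  · rintro (_ | ⟨a, l⟩) <;> rfl
  · rintro (_ | ⟨a, l⟩)
    · simp [listEquiv, lfc]
    · simp [listEquiv, lfc_cons]

/-- Decomposition of lists by length. -/
def listEquiv2 (α : Type) : Unit ⊕ (α ⊕ {l : List α // 2 ≤ l.length}) ≃ List α where
  toFun := Sum.elim (fun _ => []) (Sum.elim (fun a => [a]) (fun l => l.1))
  invFun l := match l with
    | [] => Sum.inl ()
    | [a] => Sum.inr (Sum.inl a)
    | a :: b :: l => Sum.inr (Sum.inr ⟨a :: b :: l, by simp⟩)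
  left_inv := by
    rintro (_ | a | ⟨l, hl⟩)
    · rfl
    · rfl
    · match l, hl with
      | a :: b :: l, _ => rfl
  right_inv := by
    intro l
    match l with
    | [] => rfl
    | [a] => rfl
    | a :: b :: l => rfl

theorem gN_gen (n : ℕ) (c : Bool) (w : List (Tc n c) → ℝ) :
    wgf (lsz : List (Tc n c) → ℕ) w = wgf (fun _ : Unit => 0) (fun _ => w []) +
      (wgf (fun t : Tc n c => size t.1) (fun t => w [t]) +
        wgf (fun l : Nc n c => lsz l.1) (fun l => w l.1)) := by
  have hF : FF (Sum.elim (fun t : Tc n c => size t.1) (fun l : Nc n c => lsz l.1)) := by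
    refine (FF_lsz n c).inj (fun x => listEquiv2 _ (Sum.inr x))
      ((Equiv.injective _).comp Sum.inr_injective) ?_
    rintro (a | l) <;> simp [listEquiv2, lsz, sizeList]
  rw [← wgf_sum _ _ (FF_Tc n c) (FF_Nc n c), ← wgf_sum _ _ (FF_const 0) hF]
  symm
  refine wgf_equiv (listEquiv2 _) ?_ ?_
  · rintro (_ | a | l) <;> simp [listEquiv2, lsz, sizeList]
  · rintro (_ | a | l) <;> simp [listEquiv2]

theorem gN1 (n : ℕ) (c : Bool) :
    wgf (fun l : Nc n c => lsz l.1) (fun _ => 1) = gL n c - 1 - gT n c := by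
  have h := gN_gen n c (fun _ => 1)
  rw [wgf_const] at h
  simp only [Nat.card_unique, Nat.cast_one, pow_zero, mul_one] at h
  unfold gL gT
  rw [h]
  ring

theorem gN2 (n : ℕ) (c : Bool) :
    wgf (fun l : Nc n c => lsz l.1) (fun l => (lfc (l.1.map Subtype.val) : ℝ)) =
      gP n c - (2 * n : ℝ) • X := by
  have h := gN_gen n c (fun l => (lfc (l.map Subtype.val) : ℝ))
  have h2 : (fun t : Tc n c => (lfc ([t].map Subtype.val) : ℝ)) = fun t => (lfw t.1 : ℝ) := by
    funext t
    simp only [List.map_cons, List.map_nil, lfc_cons]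
    simp [lfc]
  rw [h2, gleaf_eq] at h
  have h3 : (fun _ : Unit => (lfc (([] : List (Tc n c)).map Subtype.val) : ℝ)) = fun _ => 0 := by
    funext t
    simp [lfc]
  rw [h3, wgf_zero] at h
  unfold gP
  rw [h]
  ring

theorem leafgf (n : ℕ) : wgf (fun _ : Fin n × Bool => 1) (fun _ => 1) = (2 * n : ℝ) • X := by
  have h2 : (C (2 : ℝ) : PowerSeries ℝ) = 2 := map_ofNat C 2
  rw [wgf_const, smul_eq_C_mul]
  simp [h2, mul_comm]

theorem map_val_inj {n : ℕ} {c : Bool} {l l' : List (Tc n c)}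
    (h : l.map Subtype.val = l'.map Subtype.val) : l = l' :=
  List.map_injective_iff.2 Subtype.val_injective h

theorem node_WF {n : ℕ} (c : Bool) (l : Nc n c) : WF (AT.node c (l.1.map Subtype.val)) := by
  refine WF.node _ _ (by simpa using l.2) ?_ ?_
  · intro t ht
    obtain ⟨t', _, rfl⟩ := List.mem_map.1 ht
    exact t'.2.1
  · intro t ht
    obtain ⟨t', _, rfl⟩ := List.mem_map.1 ht
    exact t'.2.2

theorem node_surj {n : ℕ} {c : Bool} {ts : List (AT n)} (h : WF (AT.node c ts)) :
    ∃ l : Nc n c, l.1.map Subtype.val = ts := by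
  cases h with
  | node _ _ h1 h2 h3 =>
    have hl : ∀ t ∈ ts, WF t ∧ rootConn t ≠ some c := fun t ht => ⟨h2 t ht, h3 t ht⟩
    lift ts to List (Tc n c) using hl
    exact ⟨⟨ts, by simpa using h1⟩, rfl⟩

theorem gT_eq (n : ℕ) (c : Bool) :
    gT n c = (2 * n : ℝ) • X + X * (gL n (!c) - 1 - gT n (!c)) := by
  rw [← gN1, ← leafgf, ← wgf_shift, ← wgf_sum _ _ (FF_const 1) (FF_Nc1 n _)]
  symm
  let f : (Fin n × Bool) ⊕ Nc n (!c) → Tc n c :=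
    Sum.elim (fun p => ⟨AT.leaf p.1 p.2, WF.leaf _ _, by simp [rootConn]⟩)
      (fun l => ⟨AT.node (!c) (l.1.map Subtype.val), node_WF _ _, by simp [rootConn]⟩)
  have hf : Function.Bijective f := by
    constructor
    · rintro (⟨i, b⟩ | l) (⟨i', b'⟩ | l') hh
      · simpa [f] using hh
      · simp [f] at hh
      · simp [f] at hh
      · simp only [f, Sum.elim_inr, Subtype.mk.injEq, AT.node.injEq, true_and] at hh
        rw [Subtype.ext (map_val_inj hh)]
    · rintro ⟨t, ht⟩
      cases t with
      | leaf i b => exact ⟨Sum.inl (i, b), rfl⟩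
      | node d ts =>
        obtain rfl : d = !c := by
          have := ht.2
          simp only [rootConn, ne_eq, Option.some.injEq] at this
          cases d <;> cases c <;> simp_all
        obtain ⟨l, rfl⟩ := node_surj ht.1
        exact ⟨Sum.inr l, rfl⟩
  refine wgf_equiv (Equiv.ofBijective f hf) ?_ ?_
  · rintro (⟨i, b⟩ | l) <;> simp [f, size, lsz]
  · rintro (⟨i, b⟩ | l) <;> rfl

theorem gW_gen (n : ℕ) (w : Wt n → ℝ) :
    wgf (fun t : Wt n => size t.1) w =
      wgf (fun _ : Fin n × Bool => 1) (fun p => w ⟨AT.leaf p.1 p.2, WF.leaf _ _⟩) +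
      (X * wgf (fun l : Nc n true => lsz l.1) (fun l => w ⟨_, node_WF true l⟩) +
       X * wgf (fun l : Nc n false => lsz l.1) (fun l => w ⟨_, node_WF false l⟩)) := by
  let f : (Fin n × Bool) ⊕ (Nc n true ⊕ Nc n false) → Wt n :=
    Sum.elim (fun p => ⟨AT.leaf p.1 p.2, WF.leaf _ _⟩)
      (Sum.elim (fun l => ⟨_, node_WF true l⟩) (fun l => ⟨_, node_WF false l⟩))
  have hf : Function.Bijective f := by
    constructor
    · rintro (⟨i, b⟩ | l | l) (⟨i', b'⟩ | l' | l') hh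
      · simpa [f] using hh
      · simp [f] at hh
      · simp [f] at hh
      · simp [f] at hh
      · simp only [f, Sum.elim_inr, Sum.elim_inl, Subtype.mk.injEq, AT.node.injEq, true_and] at hh
        rw [Subtype.ext (map_val_inj hh)]
      · simp [f] at hh
      · simp [f] at hh
      · simp [f] at hh
      · simp only [f, Sum.elim_inr, Subtype.mk.injEq, AT.node.injEq, true_and] at hh
        rw [Subtype.ext (map_val_inj hh)]
    · rintro ⟨t, ht⟩
      cases t with
      | leaf i b => exact ⟨Sum.inl (i, b), rfl⟩
      | node d ts =>
        obtain ⟨l, rfl⟩ := node_surj ht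
        cases d
        · exact ⟨Sum.inr (Sum.inr l), rfl⟩
        · exact ⟨Sum.inr (Sum.inl l), rfl⟩
  have hF : FF (Sum.elim (fun l : Nc n true => 1 + lsz l.1) (fun l : Nc n false => 1 + lsz l.1)) := by
    refine (FF_size (n := n)).inj (fun x => (f (Sum.inr x)).1)
      (Subtype.val_injective.comp (hf.1.comp Sum.inr_injective)) ?_
    rintro (l | l) <;> simp [f, size, lsz]
  rw [← wgf_shift, ← wgf_shift, ← wgf_sum _ _ (FF_Nc1 n _) (FF_Nc1 n _), ← wgf_sum _ _ (FF_const 1) hF]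
  symm
  refine wgf_equiv (Equiv.ofBijective f hf) ?_ ?_
  · rintro (⟨i, b⟩ | l | l) <;> simp [f, size, lsz]
  · rintro (⟨i, b⟩ | l | l) <;> rfl

theorem A_eq (n m : ℕ) : (A n m : ℝ) = coeff m ((2 * n : ℝ) • X +
    (X * (gL n true - 1 - gT n true) + X * (gL n false - 1 - gT n false)) : PowerSeries ℝ) := by
  rw [← gN1, ← gN1, ← leafgf, ← gW_gen n (fun _ => 1),
    coeff_wgf_one (FF_size.inj _ Subtype.val_injective (fun _ => rfl))]
  unfold A countIn
  congr 1
  refine Nat.card_congr ?_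
  exact
    { toFun := fun t => ⟨⟨t.1, t.2.2.1⟩, t.2.2.2⟩
      invFun := fun t => ⟨t.1.1, Set.mem_univ _, t.1.2, t.2⟩
      left_inv := fun _ => rfl
      right_inv := fun _ => rfl }

theorem M_eq (n m : ℕ) :
    (Nat.card {p : AT n × ℕ // WF p.1 ∧ size p.1 = m ∧ p.2 < numLeafChildren p.1} : ℝ) =
    coeff m (X * (gP n true - (2 * n : ℝ) • X) + X * (gP n false - (2 * n : ℝ) • X) :
      PowerSeries ℝ) := by
  have h := gW_gen n (fun t => (numLeafChildren t.1 : ℝ))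
  have h0 : wgf (fun _ : Fin n × Bool => 1) (fun p => (numLeafChildren (AT.leaf p.1 p.2) : ℝ)) = 0 := by
    rw [← wgf_zero (fun _ : Fin n × Bool => 1)]
    congr 1
    funext p
    simp [numLeafChildren, rootChildren]
  have h1 : ∀ c : Bool, wgf (fun l : Nc n c => lsz l.1)
      (fun l => (numLeafChildren (AT.node c (l.1.map Subtype.val)) : ℝ)) =
      gP n c - (2 * n : ℝ) • X := fun c => gN2 n c
  rw [h0, h1, h1, zero_add] at h
  rw [← h, coeff_wgf_nat (s := fun t : Wt n => size t.1)
    (FF_size.inj _ Subtype.val_injective (fun _ => rfl)) (fun t => numLeafChildren t.1)]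
  congr 1
  refine Nat.card_congr ?_
  exact
    { toFun := fun p => ⟨(⟨p.1.1, p.2.1⟩, p.1.2), p.2.2.1, p.2.2.2⟩
      invFun := fun p => ⟨(p.1.1.1, p.1.2), p.1.1.2, p.2.1, p.2.2⟩
      left_inv := fun _ => rfl
      right_inv := fun _ => rfl }

end Trees

section Analysis
open Filter Topology

theorem contract_zero (x d : ℕ → ℝ) (q : ℝ) (hq0 : 0 ≤ q) (hq : q < 1) (hx : ∀ k, 0 ≤ x k)
    (hd : Tendsto d atTop (𝓝 0)) (h : ∀ᶠ k in atTop, x (k + 1) ≤ q * x k + d k) :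
    Tendsto x atTop (𝓝 0) := by
  rw [Metric.tendsto_atTop]
  intro ε hε
  have h1 : ∀ᶠ k in atTop, d k < ε / 2 * (1 - q) :=
    hd.eventually_lt_const (by have : 0 < 1 - q := by linarith
                               positivity)
  obtain ⟨N, hN⟩ := eventually_atTop.1 (h.and h1)
  have h2 : ∀ j, x (N + j) ≤ q ^ j * x N + ε / 2 := by
    intro j
    induction j with
    | zero => simp; linarith
    | succ j ih =>
      obtain ⟨ha, hb⟩ := hN (N + j) (by omega)
      have := mul_le_mul_of_nonneg_left ih hq0
      rw [← add_assoc, pow_succ]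
      nlinarith
  have h3 : Tendsto (fun j => q ^ j * x N) atTop (𝓝 (0 * x N)) :=
    (tendsto_pow_atTop_nhds_zero_of_lt_one hq0 hq).mul_const _
  rw [zero_mul] at h3
  obtain ⟨J, hJ⟩ := eventually_atTop.1 (h3.eventually_lt_const (half_pos hε))
  refine ⟨N + J, fun k hk => ?_⟩
  obtain ⟨j, rfl⟩ := Nat.exists_eq_add_of_le (show N ≤ k by omega)
  have := hJ j (by omega)
  have := h2 j
  rw [Real.dist_eq, sub_zero, abs_of_nonneg (hx _)]
  linarith

theorem h_lower (a : ℝ) (ha : 2 ≤ a) (h : ℕ → ℝ) (h0 : 0 < h 0)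
    (h1 : h 1 = a * h 0)
    (hrec : ∀ k : ℕ, ((k : ℝ) + 4) * h (k + 2) =
      a * (2 * k + 5) * h (k + 1) - (a ^ 2 - 4 * a) * (k + 1) * h k) (k : ℕ) :
    0 < h k ∧ a * (k + 1) * h k ≤ (k + 3) * h (k + 1) := by
  induction k with
  | zero =>
    refine ⟨h0, ?_⟩
    rw [zero_add, h1]
    push_cast
    nlinarith [mul_pos (show 0 < a by linarith) h0]
  | succ k ih =>
    obtain ⟨ih1, ih2⟩ := ih
    have hk : (0 : ℝ) ≤ k := Nat.cast_nonneg k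
    have hpos : 0 < h (k + 1) := by
      have : 0 < a * (k + 1) * h k := by positivity
      by_contra hc
      push Not at hc
      nlinarith
    refine ⟨hpos, ?_⟩
    have := hrec k
    push_cast
    rw [show (k : ℝ) + 1 + 3 = k + 4 by ring, show k + 1 + 1 = k + 2 by rfl, this]
    rcases le_total 4 a with h4 | h4
    · have h5 := mul_le_mul_of_nonneg_left ih2 (show 0 ≤ a - 4 by linarith)
      nlinarith [mul_nonneg hk hpos.le]
    · have h5 : 0 ≤ a * (4 - a) * (k + 1) * h k := by
        have : 0 ≤ 4 - a := by linarith
        positivity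
      have h6 : 0 ≤ a * (k + 3) * h (k + 1) := by positivity
      nlinarith

theorem ratio_tendsto (a : ℝ) (ha : 2 ≤ a) (h : ℕ → ℝ) (h0 : 0 < h 0)
    (h1 : h 1 = a * h 0)
    (hrec : ∀ k : ℕ, ((k : ℝ) + 4) * h (k + 2) =
      a * (2 * k + 5) * h (k + 1) - (a ^ 2 - 4 * a) * (k + 1) * h k) :
    Tendsto (fun k => h (k + 1) / h k) atTop (𝓝 (a + 2 * √a)) := by
  have hl := h_lower a ha h h0 h1 hrec
  obtain ⟨s, hs⟩ : ∃ s, s = √a := ⟨_, rfl⟩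
  have hsa : s ^ 2 = a := by rw [hs]; exact Real.sq_sqrt (by linarith)
  have hs0 : 0 ≤ s := by rw [hs]; positivity
  have hs1 : 1 < s := by nlinarith
  rw [← hs]
  have hlt : |a - 2 * s| < a := by rw [abs_lt]; constructor <;> nlinarith
  obtain ⟨c, hc⟩ : ∃ c, c = (|a - 2 * s| + a) / 2 := ⟨_, rfl⟩
  have hc1 : |a - 2 * s| < c := by linarith
  have hc2 : c < a := by linarith
  have hc0 : 0 < c := lt_of_le_of_lt (abs_nonneg _) hc1
  obtain ⟨r, hr⟩ : ∃ r : ℕ → ℝ, r = fun k => h (k + 1) / h k := ⟨_, rfl⟩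
  rw [← hr]
  have hrpos : ∀ k, 0 < r k := fun k => by rw [hr]; exact div_pos (hl _).1 (hl _).1
  have hrlow : ∀ᶠ k in atTop, c ≤ r k := by
    have ht : Tendsto (fun k : ℕ => a * (1 - 2 * (1 / ((k : ℝ) + 3)))) atTop (𝓝 (a * (1 - 2 * 0))) := by
      have : Tendsto (fun k : ℕ => 1 / ((k : ℝ) + 3)) atTop (𝓝 0) := by
        have := (tendsto_add_atTop_iff_nat 2).2 (tendsto_one_div_add_atTop_nhds_zero_nat (𝕜 := ℝ))
        refine this.congr fun k => ?_
        push_cast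
        ring
      exact ((this.const_mul 2).const_sub 1).const_mul a
    filter_upwards [ht.eventually_const_lt (show c < a * (1 - 2 * 0) by linarith)] with k hk
    refine hk.le.trans ?_
    rw [hr]
    have hk3 : (0 : ℝ) < k + 3 := by positivity
    rw [le_div_iff₀ (hl k).1, show a * (1 - 2 * (1 / ((k : ℝ) + 3))) * h k
      = a * (k + 1) * h k / (k + 3) by field_simp; ring, div_le_iff₀ hk3]
    linarith [(hl k).2]
  have hrr : ∀ k : ℕ, r (k + 1) - (a + 2 * s) = (a - 2 * s) / r k * (r k - (a + 2 * s)) +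
      (-3 * a + 3 * (a ^ 2 - 4 * a) / r k) / (k + 4) := by
    intro k
    have e1 : h (k + 1) = r k * h k := by rw [hr]; field_simp [(hl k).1.ne']
    have e2 : h (k + 2) = r (k + 1) * h (k + 1) := by rw [hr]; field_simp [(hl (k + 1)).1.ne']
    have e3 := hrec k
    rw [e2, e1] at e3
    have hk := (hl k).1
    have e4 : ((k : ℝ) + 4) * (r (k + 1) * r k) =
      a * (2 * k + 5) * r k - (a ^ 2 - 4 * a) * (k + 1) := by
      apply mul_right_cancel₀ hk.ne'
      linarith
    have hk4 : (k : ℝ) + 4 ≠ 0 := by positivity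
    have e5 : r (k + 1) = (a * (2 * k + 5) * r k - (a ^ 2 - 4 * a) * (k + 1)) / ((k + 4) * r k) := by
      rw [eq_div_iff (mul_ne_zero hk4 (hrpos k).ne')]
      linarith
    have := (hrpos k).ne'
    rw [e5]
    field_simp
    rw [← hsa]
    ring
  have hz : Tendsto (fun k => |r k - (a + 2 * s)|) atTop (𝓝 0) := by
    refine contract_zero _ (fun k : ℕ => (3 * a + 3 * |a ^ 2 - 4 * a| / c) / (k + 4)) (|a - 2 * s| / c)
      (by positivity) ((div_lt_one hc0).2 hc1) (fun _ => abs_nonneg _) ?_ ?_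
    · have := ((tendsto_add_atTop_iff_nat 4).2 (tendsto_const_div_atTop_nhds_zero_nat
        (3 * a + 3 * |a ^ 2 - 4 * a| / c)))
      simpa using this
    · filter_upwards [hrlow] with k hk
      rw [hrr k]
      have hk4 : (0 : ℝ) < k + 4 := by positivity
      refine (abs_add_le _ _).trans (add_le_add ?_ ?_)
      · rw [abs_mul, abs_div, abs_of_pos (hrpos k)]
        gcongr
      · rw [abs_div, abs_of_pos hk4]
        gcongr
        refine (abs_add_le _ _).trans (add_le_add ?_ ?_)
        · rw [abs_mul, abs_of_pos (show 0 < a by linarith)]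
          norm_num
        · rw [abs_div, abs_mul, abs_of_pos (hrpos k), abs_of_pos (show (0 : ℝ) < 3 by norm_num)]
          gcongr
  have := (tendsto_zero_iff_abs_tendsto_zero _).2 hz
  simpa using this.add_const (a + 2 * s)

theorem main_analysis (a : ℝ) (ha : 2 ≤ a) (h τ : ℕ → ℝ) (h0 : 0 < h 0)
    (h1 : h 1 = a * h 0)
    (hrec : ∀ k : ℕ, ((k : ℝ) + 4) * h (k + 2) =
      a * (2 * k + 5) * h (k + 1) - (a ^ 2 - 4 * a) * (k + 1) * h k)
    (hτ : ∀ k, h (k + 1) = 2 * (τ (k + 1) + τ k)) :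
    Tendsto (fun k => a * (h (k + 1) + (2 - a) * h k) / (2 * τ (k + 1))) atTop
      (𝓝 (2 * (√a + 1) ^ 3 / (√a + 2) ^ 2)) := by
  have hl := h_lower a ha h h0 h1 hrec
  have hr := (ratio_tendsto a ha h h0 h1 hrec)
  obtain ⟨s, hs⟩ : ∃ s, s = √a := ⟨_, rfl⟩
  have hsa : s ^ 2 = a := by rw [hs]; exact Real.sq_sqrt (by linarith)
  have hs0 : 0 ≤ s := by rw [hs]; positivity
  have hs1 : 1 < s := by nlinarith
  rw [← hs] at hr ⊢
  have hκ : 2 < a + 2 * s := by linarith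
  obtain ⟨ρ, hρ⟩ : ∃ ρ, ρ = (a + 2 * s)⁻¹ := ⟨_, rfl⟩
  have hρ0 : 0 < ρ := by rw [hρ]; positivity
  have hρ1 : ρ < 1 / 2 := by
    rw [hρ, inv_eq_one_div]
    exact one_div_lt_one_div_of_lt (by norm_num) hκ
  have hr' : Tendsto (fun k => h k / h (k + 1)) atTop (𝓝 ρ) := by
    rw [hρ]
    refine (hr.inv₀ (by linarith)).congr fun k => by rw [inv_div]
  have ht : Tendsto (fun k => 2 * τ k / h k) atTop (𝓝 (1 / (1 + ρ))) := by
    have hz : Tendsto (fun k => |2 * τ k / h k - 1 / (1 + ρ)|) atTop (𝓝 0) := by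
      refine contract_zero _ (fun k : ℕ => |ρ - h k / h (k + 1)| * |1 / (1 + ρ)|) (1 / 2)
        (by norm_num) (by norm_num) (fun _ => abs_nonneg _) ?_ ?_
      · have := ((hr'.const_sub ρ).abs).mul_const (|1 / (1 + ρ)|)
        simpa using this
      · filter_upwards [hr'.eventually_lt_const hρ1] with k hk
        have p1 := (hl k).1
        have p2 := (hl (k + 1)).1
        have e : 2 * τ (k + 1) / h (k + 1) - 1 / (1 + ρ) =
            - (h k / h (k + 1)) * (2 * τ k / h k - 1 / (1 + ρ)) +
            (ρ - h k / h (k + 1)) * (1 / (1 + ρ)) := by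
          have : 2 * τ (k + 1) = h (k + 1) - 2 * τ k := by linarith [hτ k]
          rw [this]
          field_simp
          ring
        rw [e]
        refine (abs_add_le _ _).trans ?_
        rw [abs_mul, abs_mul, abs_neg, abs_of_pos (div_pos p1 p2)]
        gcongr
    have := (tendsto_zero_iff_abs_tendsto_zero _).2 hz
    simpa using this.add_const (1 / (1 + ρ))
  have ht1 := (tendsto_add_atTop_iff_nat 1).2 ht
  have hfin := (((hr'.const_mul (2 - a)).const_add 1).const_mul a).div ht1 (by positivity)
  have hval : a * (1 + (2 - a) * ρ) / (1 / (1 + ρ)) = 2 * (s + 1) ^ 3 / (s + 2) ^ 2 := by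
    rw [hρ, ← hsa]
    have : s ^ 2 + 2 * s ≠ 0 := by positivity
    have hs' : s ≠ 0 := by positivity
    rw [show s ^ 2 + 2 * s = s * (s + 2) by ring]
    field_simp
    ring
  rw [← hval]
  refine hfin.congr fun k => ?_
  have p2 := (hl (k + 1)).1
  simp only [Pi.div_apply]
  by_cases hz : τ (k + 1) = 0
  · simp [hz]
  · field_simp

theorem e_asymp : Tendsto (fun n : ℕ => (2 * (√(2 * n) + 1) ^ 3 / (√(2 * n) + 2) ^ 2) /
    (2 * √(2 * (n : ℝ)))) atTop (𝓝 1) := by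
  have h1 : Tendsto (fun n : ℕ => √(2 * (n : ℝ))) atTop atTop :=
    Real.tendsto_sqrt_atTop.comp (tendsto_natCast_atTop_atTop.const_mul_atTop (by norm_num))
  have h2 : Tendsto (fun x : ℝ => (2 * (x + 1) ^ 3 / (x + 2) ^ 2) / (2 * x)) atTop (𝓝 1) := by
    have h3 : Tendsto (fun x : ℝ => (1 + x⁻¹) ^ 3 / (1 + 2 * x⁻¹) ^ 2) atTop
        (𝓝 ((1 + 0) ^ 3 / (1 + 2 * 0) ^ 2)) :=
      ((tendsto_inv_atTop_zero.const_add 1).pow 3).div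
        (((tendsto_inv_atTop_zero.const_mul 2).const_add 1).pow 2) (by norm_num)
    norm_num at h3
    refine h3.congr' ?_
    filter_upwards [eventually_gt_atTop 0] with x hx
    field_simp
  exact h2.comp h1

end Analysis

section Final
open PowerSeries Filter Topology

theorem sym_T (T U L K Z : PowerSeries ℝ) (h1 : L = 1 + T * L) (h2 : K = 1 + U * K)
    (h3 : T = Z + X * (K - 1 - U)) (h4 : U = Z + X * (L - 1 - T)) : T = U ∧ L = K := by
  have h5 : L - K = L * K * (T - U) := by linear_combination K * h1 - L * h2
  have h6 : (T - U) * (1 - X + X * L * K) = 0 := by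
    linear_combination h3 - h4 - X * h5
  have h7 : (1 - X + X * L * K : PowerSeries ℝ) ≠ 0 := by
    intro h
    have := congrArg (constantCoeff) h
    simp at this
  have h8 : T - U = 0 := (mul_eq_zero.1 h6).resolve_right h7
  refine ⟨sub_eq_zero.1 h8, sub_eq_zero.1 ?_⟩
  rw [h5, h8, mul_zero]

theorem final_alg (a : ℝ) (ha : 2 ≤ a) (T L : PowerSeries ℝ) (hL : L = 1 + T * L)
    (hT : T = C a * X + X * (L - 1 - T)) :
    ∃ h τ : ℕ → ℝ, 0 < h 0 ∧ h 1 = a * h 0 ∧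
      (∀ k : ℕ, ((k : ℝ) + 4) * h (k + 2) =
        a * (2 * k + 5) * h (k + 1) - (a ^ 2 - 4 * a) * (k + 1) * h k) ∧
      (∀ k, h (k + 1) = 2 * (τ (k + 1) + τ k)) ∧
      (∀ k, coeff (k + 3) (C a * X + (X * (L - 1 - T) + X * (L - 1 - T))) = 2 * τ (k + 1)) ∧
      (∀ k, coeff (k + 3) (X * (C a * X * L ^ 2 - C a * X) + X * (C a * X * L ^ 2 - C a * X)) =
        a * (h (k + 1) + (2 - a) * h k)) := by
  have hLT : L * (1 - T) = 1 := by linear_combination hL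
  obtain ⟨G, hG⟩ : ∃ G : PowerSeries ℝ, G = 1 + C a * X - 2 * (1 + X) * T := ⟨_, rfl⟩
  have hquad : (1 + X) * T ^ 2 - (1 + C a * X) * T + C a * X = 0 := by
    linear_combination (-(1 - T)) * hT - X * hLT
  have hG2 : G * G = 1 - C (2 * a) * X + C (a ^ 2 - 4 * a) * X ^ 2 := by
    rw [hG]
    simp only [map_sub, map_mul, map_ofNat, map_pow]
    linear_combination 4 * (1 + X) * hquad
  have hXL : X * L = (1 + X) * T - (C a - 1) * X := by linear_combination -hT
  have hXL2 : X * L ^ 2 = (1 + (2 - C a) * X) * L - (1 + X) := by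
    linear_combination L * hXL - (1 + X) * hLT
  have hM : X * (C a * X * L ^ 2 - C a * X) + X * (C a * X * L ^ 2 - C a * X) =
      C a * (1 + C (2 * (2 - a) - 2) * X + C ((2 - a) ^ 2 - 4) * X ^ 2 -
        (G + C (2 - a) * (X * G))) := by
    simp only [map_sub, map_mul, map_ofNat, map_pow]
    linear_combination 2 * C a * X * hXL2 + 2 * C a * (1 + (2 - C a) * X) * hXL +
      C a * (1 + (2 - C a) * X) * hG
  have hA : C a * X + (X * (L - 1 - T) + X * (L - 1 - T)) = C 2 * T - C a * X := by
    simp only [map_ofNat]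
    linear_combination -2 * hT
  have hG' : G = 1 + C a * X - C 2 * T - C 2 * (X * T) := by
    simp only [map_ofNat]
    linear_combination hG
  have hD : G * derivative ℝ G + G * derivative ℝ G = - C (2 * a) + C (2 * (a ^ 2 - 4 * a)) * X := by
    have := congrArg (derivative ℝ) hG2
    simp only [Derivation.leibniz, map_add, map_sub, derivative_C, derivative_X, smul_eq_mul,
      Derivation.leibniz_pow, Derivation.map_one_eq_zero] at this
    rw [this]
    simp only [map_sub, map_mul, map_ofNat, map_pow]
    simp
    ring
  obtain ⟨F, hF⟩ : ∃ F, F = derivative ℝ G := ⟨_, rfl⟩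
  rw [← hF] at hD
  have hDE : F - C (2 * a) * (X * F) + C (a ^ 2 - 4 * a) * (X * (X * F)) =
      - (C a * G) + C (a ^ 2 - 4 * a) * (X * G) := by
    have h2 : (C 2 : PowerSeries ℝ) ≠ 0 := by
      intro h
      have := congrArg (constantCoeff) h
      simp at this
    apply mul_left_cancel₀ h2
    simp only [map_sub, map_mul, map_ofNat, map_pow] at *
    linear_combination G * hD - 2 * F * hG2
  obtain ⟨b, hb⟩ : ∃ b, b = a ^ 2 - 4 * a := ⟨_, rfl⟩
  rw [← hb] at hDE ⊢
  have hFc : ∀ k, coeff k F = coeff (k + 1) G * (k + 1) := fun k => by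
    rw [hF, coeff_derivative]
  have hrec : ∀ k : ℕ, ((k : ℝ) + 3) * coeff (k + 3) G = a * (2 * k + 3) * coeff (k + 2) G -
      b * k * coeff (k + 1) G := by
    intro k
    have := congrArg (coeff (k + 2)) hDE
    simp only [map_add, map_sub, map_neg, coeff_C_mul, coeff_succ_X_mul, hFc,
      show k + 2 = (k + 1) + 1 from rfl] at this
    push_cast at this
    linear_combination this
  have hT0 : constantCoeff T = 0 := by
    rw [hT]
    simp
  have g0 : coeff 0 G = 1 := by
    rw [hG']
    simp [hT0]
  have e0 := congrArg (coeff 0) hDE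
  have e1 := congrArg (coeff (0 + 1)) hDE
  simp only [map_add, map_sub, map_neg, coeff_C_mul, coeff_zero_X_mul, hFc, coeff_succ_X_mul] at e0 e1
  norm_num [g0] at e0 e1
  have g2 : coeff 2 G = -2 * a := by
    rw [e0, hb] at e1
    linarith
  refine ⟨fun k => - coeff (k + 2) G, fun k => coeff (k + 2) T, ?_, ?_, ?_, ?_, ?_, ?_⟩
  · simp only [zero_add, g2]
    linarith
  · have := hrec 0
    norm_num at this ⊢
    linarith
  · intro k
    have := hrec (k + 1)
    push_cast at this
    simp only [show k + 1 + 3 = k + 2 + 2 from rfl] at this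
    linear_combination - this
  · intro k
    have := congrArg (coeff (k + 3)) hG'
    simp only [map_add, map_sub, coeff_C_mul, coeff_one, coeff_X, coeff_succ_X_mul,
      show k + 3 = (k + 2) + 1 from rfl] at this
    norm_num at this
    show - coeff (k + 2 + 1) G = 2 * (coeff (k + 2 + 1) T + coeff (k + 2) T)
    linarith
  · intro k
    rw [hA]
    simp [coeff_C_mul]
  · intro k
    rw [hM]
    generalize 2 * (2 - a) - 2 = u
    generalize (2 - a) ^ 2 - 4 = v
    generalize 2 - a = y
    simp only [map_add, map_sub, coeff_C_mul, coeff_one, coeff_X, coeff_X_pow, coeff_succ_X_mul,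
      show k + 3 = (k + 2) + 1 from rfl]
    norm_num
    left
    rw [if_neg (by omega)]
    ring_nf

theorem EX_tendsto (n : ℕ) (hn : 1 ≤ n) :
    Tendsto (fun m => EX n m) atTop (𝓝 (2 * (√(2 * n) + 1) ^ 3 / (√(2 * n) + 2) ^ 2)) := by
  have hA := A_eq n
  have hM := M_eq n
  have hLt := gL_eq n true
  have hLf := gL_eq n false
  have hTt := gT_eq n true
  have hTf := gT_eq n false
  have hPt := gP_eq n true
  have hPf := gP_eq n false
  have ha2 : 2 ≤ (2 * n : ℝ) := by
    have : (1 : ℝ) ≤ n := by exact_mod_cast hn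
    linarith
  simp only [Bool.not_true, Bool.not_false] at hTt hTf
  generalize (2 * n : ℝ) = a at *
  simp only [smul_eq_C_mul] at *
  obtain ⟨hTT, hLL⟩ := sym_T _ _ _ _ _ hLt hLf hTt hTf
  rw [← hTT, ← hLL] at hA hTt hPf
  generalize gT n true = T at *
  generalize gL n true = L at *
  have hP1 : gP n true = C a * X * L ^ 2 := by linear_combination L * hPt - gP n true * hLt
  have hP2 : gP n false = C a * X * L ^ 2 := by linear_combination L * hPf - gP n false * hLt
  rw [hP1, hP2] at hM
  obtain ⟨h, τ, h0, h1, h2, h3, h4, h5⟩ := final_alg a ha2 T L hLt hTt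
  have := main_analysis a ha2 h τ h0 h1 h2 h3
  rw [← tendsto_add_atTop_iff_nat 3]
  refine this.congr fun k => ?_
  unfold EX
  rw [hM, hA, h4, h5]

end Final

open Filter in
/-- For every `n ≥ 1` the limit `e_n = lim_{m→∞} E[X_{m,n}]` exists, and
`e_n ∼ 2√(2n)` as `n → ∞`. -/
theorem statement8 :
    ∃ e : ℕ → ℝ,
      (∀ n : ℕ, 1 ≤ n → Tendsto (fun m => EX n m) atTop (nhds (e n))) ∧
      Tendsto (fun n : ℕ => e n / (2 * Real.sqrt (2 * n))) atTop (nhds 1) := by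
  exact ⟨_, EX_tendsto, e_asymp⟩
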